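/- arXiv:2501.11125 — 2 statements merged into one kernel-verified Lean document; each statement's English description precedes it below -/
import Mathlib

section
/- Let K be an algebraically closed field, V = K^m with standard basis v_1, …, v_m, and let k_1, …, k_m be integers with k_1 + ⋯ + k_m ≠ 0. Let S = { diag(t^{k_1}, …, t^{k_m}) : t ∈ K^× } ⊂ GL(V). Then there exist C > 0 and N such that TS_S(V^{⊗n}) ≤ (m e^{−C})^n for all n > N; in particular d(S, V) < m. -/
open CategoryTheory MonoidalCategory Limits

noncomputable section

universe u

/-- The `n`-th tensor power of a representation, in the category `Rep k G`. -/
def tpow {k G : Type u} [Field k] [Monoid G] (V : Rep k G) : ℕ → Rep k G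
  | 0 => 𝟙_ (Rep k G)
  | n + 1 => tpow V n ⊗ V

/-- `TS V` : the number of trivial direct summands of `V`, counted with multiplicity, i.e.
the largest `n` such that the trivial representation on `k^n` is a direct summand of `V`. -/
def TS {k G : Type u} [Field k] [Monoid G] (V : Rep k G) : ℕ :=
  sSup {n : ℕ | ∃ W : Rep k G, Nonempty (V ≅ Rep.trivial k G (Fin n → k) ⊞ W)}

/-- `dG V = limsup_{n → ∞} TS(V^{⊗n})^(1/n)`. -/
def dG {k G : Type u} [Field k] [Monoid G] (V : Rep k G) : ℝ :=
  Filter.limsup (fun n : ℕ => (TS (tpow V n) : ℝ) ^ ((n : ℝ)⁻¹)) Filter.atTop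

/-- The representation on `k^m` induced by a group homomorphism to `GL_m(k)`. -/
def matRep {k G : Type u} [Field k] [Monoid G] {m : ℕ}
    (ρ : G →* Matrix.GeneralLinearGroup (Fin m) k) : Representation k G (Fin m → k) :=
  (Matrix.toLinAlgEquiv'.toRingEquiv.toRingHom.toMonoidHom).comp
    ((Units.coeHom (Matrix (Fin m) (Fin m) k)).comp ρ)

/-- The one-parameter diagonal subgroup data: `t ↦ (t ^ kw 1, …, t ^ kw m)` as units. -/
def diagUnitsPow {k : Type u} [Field k] {m : ℕ} (kw : Fin m → ℤ) : kˣ →* (Fin m → k)ˣ where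
  toFun t :=
    ⟨fun i => ((t ^ kw i : kˣ) : k), fun i => (((t ^ kw i)⁻¹ : kˣ) : k),
      funext fun i => Units.mul_inv _, funext fun i => Units.inv_mul _⟩
  map_one' := by ext i; simp
  map_mul' s t := by ext i; simp [mul_zpow]

/-- The homomorphism `t ↦ diag(t ^ kw 1, …, t ^ kw m) : kˣ → GL_m(k)`. -/
def diagHom {k : Type u} [Field k] {m : ℕ} (kw : Fin m → ℤ) :
    kˣ →* Matrix.GeneralLinearGroup (Fin m) k :=
  (Units.map (Matrix.diagonalRingHom (Fin m) k).toMonoidHom).comp (diagUnitsPow kw)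

/-- The one-dimensional torus `S = { diag(t ^ kw 1, …, t ^ kw m) : t ∈ kˣ } ⊆ GL_m(k)`. -/
def diagTorus {k : Type u} [Field k] {m : ℕ} (kw : Fin m → ℤ) :
    Subgroup (Matrix.GeneralLinearGroup (Fin m) k) :=
  (diagHom kw).range

theorem exists_zpow_ne_one {k : Type*} [Field k] [IsAlgClosed k] {w : ℤ} (hw : w ≠ 0) :
    ∃ t : kˣ, t ^ w ≠ 1 := by
  classical
  have := IsAlgClosed.instInfinite (K := k)
  obtain ⟨a, ha⟩ := Infinite.exists_notMem_finset ({0, 1} : Finset k)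
  simp only [Finset.mem_insert, Finset.mem_singleton, not_or] at ha
  obtain ⟨z, hz⟩ := IsAlgClosed.exists_pow_nat_eq a (Int.natAbs_pos.2 hw)
  have hz0 : z ≠ 0 := by
    rintro rfl
    rw [zero_pow (Int.natAbs_ne_zero.2 hw)] at hz
    exact ha.1 hz.symm
  refine ⟨Units.mk0 z hz0, fun h => ha.2 ?_⟩
  have h' : Units.mk0 z hz0 ^ w.natAbs = 1 := by
    rcases Int.natAbs_eq w with hw' | hw' <;> rw [hw'] at h <;> simpa using h
  simpa [hz] using congrArg Units.val h'

/-- Trivial summands embed into the invariants; this bounds their number by the number of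
zero weights of a weight basis. -/
theorem TS_le_card_weight_zero {k G : Type u} [Field k] [IsAlgClosed k] [Monoid G]
    (φ : kˣ →* G) (V : Rep.{u} k G) {ι : Type*} [Fintype ι] (b : Module.Basis ι k V) (w : ι → ℤ)
    (hb : ∀ t i, V.ρ (φ t) (b i) = ((t ^ w i : kˣ) : k) • b i) :
    TS V ≤ Fintype.card {i // w i = 0} := by
  refine csSup_le' ?_
  rintro n ⟨W, ⟨e⟩⟩
  let f : Rep.trivial k G (Fin n → k) ⟶ V := biprod.inl ≫ e.inv
  have hf : Function.Injective f.hom := (Rep.mono_iff_injective f).1 inferInstance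
  have hinv (x : Fin n → k) (g : G) : V.ρ g (f.hom x) = f.hom x :=
    (Rep.hom_comm_apply f g x).symm
  have hcoord (x : Fin n → k) (i : ι) (hi : w i ≠ 0) : b.repr (f.hom x) i = 0 := by
    obtain ⟨t, ht⟩ := exists_zpow_ne_one (k := k) hi
    have hact (v : V) : b.repr (V.ρ (φ t) v) i = ((t ^ w i : kˣ) : k) * b.repr v i := by
      have : b.coord i ∘ₗ V.ρ (φ t) = ((t ^ w i : kˣ) : k) • b.coord i := by
        classical
        refine b.ext fun j => ?_
        by_cases hj : j = i
        · subst hj; simp [hb]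
        · simp [hb, hj]
      exact LinearMap.congr_fun this v
    have h := hact (f.hom x)
    rw [hinv] at h
    by_contra hne
    exact ht (Units.ext (mul_right_cancel₀ hne (by rw [← h, Units.val_one, one_mul])))
  let F : (Fin n → k) →ₗ[k] ({i // w i = 0} → k) :=
    LinearMap.pi fun i => b.coord i.1 ∘ₗ f.hom.toLinearMap
  have hF : Function.Injective F := fun x y hxy => hf <| b.ext_elem fun i => by
    by_cases hi : w i = 0
    · exact congrFun hxy ⟨i, hi⟩
    · rw [hcoord x i hi, hcoord y i hi]
  simpa using LinearMap.finrank_le_finrank_of_injective hF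

theorem exists_weight_basis_tpow {k G : Type u} [Field k] [Monoid G] (φ : kˣ →* G)
    (V : Rep.{u} k G) {ι : Type} [Fintype ι] (b : Module.Basis ι k V) (w : ι → ℤ)
    (hb : ∀ t i, V.ρ (φ t) (b i) = ((t ^ w i : kˣ) : k) • b i) (n : ℕ) :
    ∃ (κ : Type) (_ : Fintype κ) (c : Module.Basis κ k (tpow V n)) (v : κ → ℤ),
      (∀ t i, (tpow V n).ρ (φ t) (c i) = ((t ^ v i : kˣ) : k) • c i) ∧
      ∀ s : ℝ, ∑ i, Real.exp (s * v i) = (∑ i, Real.exp (s * w i)) ^ n := by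
  induction n with
  | zero =>
    refine ⟨Unit, inferInstance, Module.Basis.singleton Unit k, fun _ => 0, fun t i => ?_,
      fun s => by simp⟩
    simp only [zpow_zero, Units.val_one, one_smul]
    rfl
  | succ n ih =>
    obtain ⟨κ, _, c, v, hc, hv⟩ := ih
    refine ⟨κ × ι, inferInstance, c.tensorProduct b, fun p => v p.1 + w p.2, fun t p => ?_,
      fun s => ?_⟩
    · change TensorProduct.map ((tpow V n).ρ (φ t)) (V.ρ (φ t)) (c.tensorProduct b p) = _
      rw [Module.Basis.tensorProduct_apply', TensorProduct.map_tmul, hc, hb,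
        TensorProduct.smul_tmul_smul, zpow_add, Units.val_mul]
      exact congrArg _ (c.tensorProduct_apply' b p).symm
    · rw [pow_succ, ← hv, Finset.sum_mul_sum, Fintype.sum_prod_type]
      simp [mul_add, Real.exp_add]

theorem exists_sum_exp_lt_card {ι : Type*} [Fintype ι] (w : ι → ℤ) (hw : ∑ i, w i ≠ 0) :
    ∃ s : ℝ, ∑ i, Real.exp (s * w i) < Fintype.card ι := by
  by_contra! h
  have hd : HasDerivAt (fun s : ℝ => ∑ i, Real.exp (s * w i))
      (∑ i, Real.exp (0 * w i) * (1 * w i)) 0 :=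
    HasDerivAt.fun_sum fun i _ => ((hasDerivAt_id (0 : ℝ)).mul_const (w i : ℝ)).exp
  have hmin : IsLocalMin (fun s : ℝ => ∑ i, Real.exp (s * w i)) 0 :=
    Filter.Eventually.of_forall fun s => by simpa using h s
  have h0 := hmin.hasDerivAt_eq_zero hd
  simp only [zero_mul, Real.exp_zero, one_mul] at h0
  exact hw (by exact_mod_cast h0)

theorem TS_tpow_diagTorus_le {k : Type u} [Field k] [IsAlgClosed k] {m : ℕ} (kw : Fin m → ℤ)
    (s : ℝ) (n : ℕ) :
    (TS (tpow (Rep.of (matRep (diagTorus (k := k) kw).subtype)) n) : ℝ) ≤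
      (∑ i, Real.exp (s * kw i)) ^ n := by
  let φ : kˣ →* diagTorus (k := k) kw := (diagHom kw).rangeRestrict
  obtain ⟨κ, _, c, v, hc, hv⟩ := exists_weight_basis_tpow φ
    (Rep.of (matRep (diagTorus (k := k) kw).subtype)) (Pi.basisFun k (Fin m)) kw
    (fun t i => by
      change (Matrix.diagonal fun j => ((t ^ kw j : kˣ) : k)).mulVec (Pi.basisFun k (Fin m) i) = _
      rw [Pi.basisFun_apply, Matrix.diagonal_mulVec_single, ← smul_eq_mul, Pi.single_smul]) n
  rw [← hv s]
  calc (TS (tpow (Rep.of (matRep (diagTorus (k := k) kw).subtype)) n) : ℝ)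
      ≤ (Fintype.card {i // v i = 0} : ℝ) := by
        exact_mod_cast TS_le_card_weight_zero φ _ c v hc
    _ = ∑ i with v i = 0, Real.exp (s * v i) := by
        rw [Fintype.card_subtype, Finset.card_eq_sum_ones, Nat.cast_sum]
        refine Finset.sum_congr rfl fun i hi => ?_
        simp [(Finset.mem_filter.1 hi).2]
    _ ≤ ∑ i, Real.exp (s * v i) :=
        Finset.sum_le_sum_of_subset_of_nonneg (Finset.filter_subset _ _)
          fun i _ _ => (Real.exp_pos _).le

/-- **Theorem.** For the one-dimensional torus `S = { diag(t^{k_1}, …, t^{k_m}) }` with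
`k_1 + ⋯ + k_m ≠ 0`, there are `C > 0` and `N` with `TS_S(V^{⊗n}) ≤ (m e^{-C})^n` for all
`n > N`; in particular `d(S, V) < m`. -/
theorem TS_torus_exponentially_small {k : Type u} [Field k] [IsAlgClosed k] {m : ℕ}
    (kw : Fin m → ℤ) (hkw : (∑ i : Fin m, kw i) ≠ 0) :
    (∃ C : ℝ, 0 < C ∧ ∃ N : ℕ, ∀ n : ℕ, n > N →
        (TS (tpow (Rep.of (matRep (diagTorus (k := k) kw).subtype)) n) : ℝ) ≤
          ((m : ℝ) * Real.exp (-C)) ^ n) ∧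
      dG (Rep.of (matRep (diagTorus (k := k) kw).subtype)) < (m : ℝ) := by
  obtain ⟨s, hs⟩ := exists_sum_exp_lt_card kw hkw
  rw [Fintype.card_fin] at hs
  have hle := TS_tpow_diagTorus_le (k := k) kw s
  set r : ℝ := ∑ i, Real.exp (s * kw i) with hr
  have : Nonempty (Fin m) := by
    by_contra hm
    rw [not_nonempty_iff] at hm
    exact hkw (Finset.sum_of_isEmpty _)
  have hr0 : 0 < r := Finset.sum_pos (fun i _ => Real.exp_pos _) Finset.univ_nonempty
  have hm0 : (0 : ℝ) < m := hr0.trans hs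
  refine ⟨⟨Real.log (m / r), Real.log_pos ((one_lt_div hr0).2 hs), 0, fun n _ => ?_⟩, ?_⟩
  · have : (m : ℝ) * Real.exp (-Real.log (m / r)) = r := by
      rw [Real.exp_neg, Real.exp_log (div_pos hm0 hr0)]
      field_simp
    rw [this]
    exact hle n
  · refine lt_of_le_of_lt ?_ hs
    refine Filter.limsup_le_of_le
      (Filter.isCoboundedUnder_le_of_le _ (x := 0) fun n => by positivity) ?_
    filter_upwards [Filter.eventually_ne_atTop 0] with n hn
    calc _ ≤ (r ^ n) ^ ((n : ℝ)⁻¹) :=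
          Real.rpow_le_rpow (Nat.cast_nonneg _) (hle n) (by positivity)
      _ = r := Real.pow_rpow_inv_natCast hr0.le hn
end
end

section
/- Let K be algebraically closed of characteristic 0 and let V be an m-dimensional vector space over K, regarded as the natural representation of SL(V). Then the sequence a_n = TS_{SL(V)}(V^{⊗mn}) satisfies a_n > 0 and a_{l+k} ≥ a_l · a_k for all l, k, the limit lim_{n→∞} TS_{SL(V)}(V^{⊗mn})^{1/mn} exists, and it equals m. -/
open CategoryTheory MonoidalCategory Limits

noncomputable section

universe u

/-- The natural `m`-dimensional representation of `SL_m(k)`. -/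
def natRepSL (k : Type u) [Field k] (m : ℕ) : Rep k (Matrix.SpecialLinearGroup (Fin m) k) :=
  Rep.of (matRep Matrix.SpecialLinearGroup.toGL)

section Retracts
variable {k G : Type u} [Field k] [Monoid G]

theorem exists_iso_biprod_iff {V X : Rep.{u} k G} :
    (∃ W : Rep.{u} k G, Nonempty (V ≅ X ⊞ W)) ↔ ∃ (i : X ⟶ V) (r : V ⟶ X), i ≫ r = 𝟙 X := by
  constructor
  · rintro ⟨W, ⟨e⟩⟩
    exact ⟨biprod.inl ≫ e.inv, e.hom ≫ biprod.fst, by simp⟩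
  · rintro ⟨i, r, h⟩
    have : IsSplitMono i := ⟨⟨r, h⟩⟩
    exact ⟨cokernel i, ⟨biprod.uniqueUpToIso _ _
      (isBilimitBinaryBiconeOfIsSplitMonoOfCokernel (cokernelIsCokernel i))⟩⟩

theorem TS_eq (V : Rep.{u} k G) :
    TS V = sSup {n : ℕ | ∃ (i : Rep.trivial k G (Fin n → k) ⟶ V)
      (r : V ⟶ Rep.trivial k G (Fin n → k)), i ≫ r = 𝟙 _} := by
  unfold TS
  congr 1
  ext n
  exact exists_iso_biprod_iff

theorem le_finrank_of_retract {V : Rep.{u} k G} [Module.Finite k V.V] {n : ℕ}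
    (i : Rep.trivial k G (Fin n → k) ⟶ V) (r : V ⟶ Rep.trivial k G (Fin n → k))
    (h : i ≫ r = 𝟙 _) : n ≤ Module.finrank k V.V := by
  have hi : Function.Injective i.hom.toLinearMap := by
    intro x y hxy
    have h1 := congrArg (fun f => (Rep.Hom.hom f) x) h
    have h2 := congrArg (fun f => (Rep.Hom.hom f) y) h
    simp only [Rep.hom_comp, Rep.hom_id] at h1 h2
    change r.hom (i.hom x) = x at h1
    change r.hom (i.hom y) = y at h2
    change i.hom x = i.hom y at hxy
    rw [← h1, ← h2, hxy]
  simpa using LinearMap.finrank_le_finrank_of_injective hi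

theorem TS_le_finrank (V : Rep.{u} k G) [Module.Finite k V.V] : TS V ≤ Module.finrank k V.V := by
  rw [TS_eq]
  refine csSup_le' ?_
  rintro n ⟨i, r, h⟩
  exact le_finrank_of_retract i r h

theorem le_TS {V : Rep.{u} k G} [Module.Finite k V.V] {n : ℕ}
    (i : Rep.trivial k G (Fin n → k) ⟶ V) (r : V ⟶ Rep.trivial k G (Fin n → k))
    (h : i ≫ r = 𝟙 _) : n ≤ TS V := by
  rw [TS_eq]
  refine le_csSup ⟨Module.finrank k V.V, ?_⟩ ⟨i, r, h⟩
  rintro n ⟨i, r, h⟩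
  exact le_finrank_of_retract i r h

theorem exists_retract_TS (V : Rep.{u} k G) [Module.Finite k V.V] :
    ∃ (i : Rep.trivial k G (Fin (TS V) → k) ⟶ V)
      (r : V ⟶ Rep.trivial k G (Fin (TS V) → k)), i ≫ r = 𝟙 _ := by
  have := Nat.sSup_mem (s := {n : ℕ | ∃ (i : Rep.trivial k G (Fin n → k) ⟶ V)
      (r : V ⟶ Rep.trivial k G (Fin n → k)), i ≫ r = 𝟙 _})
    ⟨0, 0, 0, Rep.hom_ext <| DFunLike.ext _ _ fun _ => Subsingleton.elim (α := Fin 0 → k) _ _⟩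
    ⟨Module.finrank k V.V, by
      rintro n ⟨i, r, h⟩
      exact le_finrank_of_retract i r h⟩
  rw [← TS_eq] at this
  exact this

/-- The tensor product of trivial representations is trivial. -/
def trivialTensorIso (a b : ℕ) :
    (Rep.trivial k G (Fin a → k) ⊗ Rep.trivial k G (Fin b → k) : Rep.{u} k G) ≅
      Rep.trivial k G (Fin (a * b) → k) :=
  Rep.mkIso <| .mk
    (((Pi.basisFun k (Fin a)).tensorProduct (Pi.basisFun k (Fin b))).equivFun ≪≫ₗ
      LinearEquiv.funCongrLeft k k finProdFinEquiv.symm)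
    fun _ => TensorProduct.ext' fun _ _ => rfl

theorem TS_mul_le (V W : Rep.{u} k G) [Module.Finite k V.V] [Module.Finite k W.V] :
    TS V * TS W ≤ TS (V ⊗ W) := by
  obtain ⟨i, r, h⟩ := exists_retract_TS V
  obtain ⟨i', r', h'⟩ := exists_retract_TS W
  have : Module.Finite k (V ⊗ W : Rep k G).V :=
    inferInstanceAs (Module.Finite k (TensorProduct k V.V W.V))
  refine le_TS ((trivialTensorIso _ _).inv ≫ (i ⊗ₘ i')) ((r ⊗ₘ r') ≫ (trivialTensorIso _ _).hom) ?_
  rw [Category.assoc, MonoidalCategory.tensorHom_comp_tensorHom_assoc, h, h']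
  simp

theorem TS_congr {V W : Rep.{u} k G} (e : V ≅ W) : TS V = TS W := by
  unfold TS
  congr 1
  ext n
  exact ⟨fun ⟨X, ⟨f⟩⟩ => ⟨X, ⟨e.symm ≪≫ f⟩⟩, fun ⟨X, ⟨f⟩⟩ => ⟨X, ⟨e ≪≫ f⟩⟩⟩

/-- Tensor powers are additive in the exponent. -/
def tpowAddIso (V : Rep.{u} k G) (a : ℕ) : ∀ b, tpow V (a + b) ≅ tpow V a ⊗ tpow V b
  | 0 => (ρ_ _).symm
  | b + 1 => (tpowAddIso V a b ⊗ᵢ Iso.refl V) ≪≫ α_ _ _ _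

instance tpow_finite (V : Rep.{u} k G) [Module.Finite k V.V] : ∀ n, Module.Finite k (tpow V n).V
  | 0 => inferInstanceAs (Module.Finite k k)
  | n + 1 =>
    have := tpow_finite V n
    inferInstanceAs (Module.Finite k (TensorProduct k (tpow V n).V V.V))

theorem finrank_tpow (V : Rep.{u} k G) (n : ℕ) :
    Module.finrank k (tpow V n).V = Module.finrank k V.V ^ n := by
  induction n with
  | zero => exact Module.finrank_self k
  | succ n ih =>
    rw [pow_succ, ← ih]
    exact Module.finrank_tensorProduct

end Retracts

section Coordinates
variable {k : Type u} [Field k] {m : ℕ}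

/-- Tensoring on the right with a vector of the natural representation. -/
def tpowSnoc (N : ℕ) :
    (tpow (natRepSL k m) N).V →ₗ[k] (Fin m → k) →ₗ[k] (tpow (natRepSL k m) (N + 1)).V :=
  TensorProduct.mk k (tpow (natRepSL k m) N).V (Fin m → k)

/-- The standard basis vectors of the tensor powers of the natural representation. -/
def tpowVec : (N : ℕ) → (Fin N → Fin m) → (tpow (natRepSL k m) N).V
  | 0, _ => (1 : k)
  | N + 1, u => tpowSnoc N (tpowVec N (Fin.init u)) (Pi.single (u (Fin.last N)) 1)

/-- The coordinate functionals dual to `tpowVec`. -/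
def tpowCoord : (N : ℕ) → (Fin N → Fin m) → ((tpow (natRepSL k m) N).V →ₗ[k] k)
  | 0, _ => LinearMap.id (R := k) (M := k)
  | N + 1, u => LinearMap.mul' k k ∘ₗ TensorProduct.map (tpowCoord N (Fin.init u))
      (LinearMap.proj (R := k) (φ := fun _ : Fin m => k) (u (Fin.last N)))

theorem tpowCoord_tpowSnoc {N : ℕ} (u : Fin (N + 1) → Fin m) (x : (tpow (natRepSL k m) N).V)
    (y : Fin m → k) : tpowCoord (N + 1) u (tpowSnoc N x y) =
      tpowCoord N (Fin.init u) x * y (u (Fin.last N)) :=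
  rfl

theorem tpow_ρ_tpowSnoc {N : ℕ} (g : Matrix.SpecialLinearGroup (Fin m) k)
    (x : (tpow (natRepSL k m) N).V) (y : Fin m → k) :
    (tpow (natRepSL k m) (N + 1)).ρ g (tpowSnoc N x y) =
      tpowSnoc N ((tpow (natRepSL k m) N).ρ g x) (Matrix.mulVec g.val y) :=
  rfl

theorem tpowSnoc_hom_ext {N : ℕ} {M : Type*} [AddCommGroup M] [Module k M]
    {f g : (tpow (natRepSL k m) (N + 1)).V →ₗ[k] M}
    (h : ∀ x y, f (tpowSnoc N x y) = g (tpowSnoc N x y)) : f = g :=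
  TensorProduct.ext' h

theorem tpowCoord_tpowVec {N : ℕ} (u v : Fin N → Fin m) :
    tpowCoord (k := k) N u (tpowVec N v) = if u = v then 1 else 0 := by
  induction N with
  | zero => rw [if_pos (Subsingleton.elim u v)]; rfl
  | succ N ih =>
    rw [tpowVec, tpowCoord_tpowSnoc, ih, Pi.single_apply, ite_zero_mul_ite_zero, mul_one]
    congr 1
    refine propext ⟨fun ⟨h1, h2⟩ => ?_, fun h => by simp [h]⟩
    rw [← Fin.snoc_init_self u, ← Fin.snoc_init_self v, h1, h2]

theorem sum_fin_succ_pi {M : Type*} [AddCommMonoid M] {N : ℕ} (f : (Fin (N + 1) → Fin m) → M) :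
    ∑ v, f v = ∑ v : Fin N → Fin m, ∑ a : Fin m, f (Fin.snoc (α := fun _ => Fin m) v a) := by
  rw [← (Fin.snocEquiv fun _ => Fin m).sum_comp, Fintype.sum_prod_type, Finset.sum_comm]
  rfl

theorem tpow_ρ_tpowVec (g : Matrix.SpecialLinearGroup (Fin m) k) {N : ℕ} (u : Fin N → Fin m) :
    (tpow (natRepSL k m) N).ρ g (tpowVec N u) =
      ∑ v : Fin N → Fin m, (∏ p, g.val (v p) (u p)) • tpowVec N v := by
  induction N with
  | zero =>
    simp only [Finset.univ_unique, Finset.univ_eq_empty, Finset.prod_empty, Finset.sum_singleton,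
      one_smul]
    rfl
  | succ N ih =>
    rw [tpowVec, tpow_ρ_tpowSnoc, ih, sum_fin_succ_pi, Matrix.mulVec_single_one,
      pi_eq_sum_univ' (Matrix.col _ _), map_sum (tpowSnoc N), LinearMap.sum_apply]
    refine Finset.sum_congr rfl fun v _ => ?_
    rw [map_sum]
    refine Finset.sum_congr rfl fun a _ => ?_
    simp only [tpowVec, Fin.init_snoc, Fin.snoc_last, Fin.prod_univ_castSucc, Fin.snoc_castSucc]
    rw [map_smul, map_smul, LinearMap.smul_apply, smul_smul, mul_comm]
    rfl

theorem tpowCoord_ρ (g : Matrix.SpecialLinearGroup (Fin m) k) {N : ℕ} (u : Fin N → Fin m)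
    (x : (tpow (natRepSL k m) N).V) :
    tpowCoord N u ((tpow (natRepSL k m) N).ρ g x) =
      ∑ v : Fin N → Fin m, (∏ p, g.val (u p) (v p)) * tpowCoord N v x := by
  induction N with
  | zero =>
    simp only [Finset.univ_unique, Finset.univ_eq_empty, Finset.prod_empty, Finset.sum_singleton,
      one_mul]
    rfl
  | succ N ih =>
    suffices h : tpowCoord (N + 1) u ∘ₗ (tpow (natRepSL k m) (N + 1)).ρ g =
        ∑ v : Fin (N + 1) → Fin m, (∏ p, g.val (u p) (v p)) • tpowCoord (N + 1) v by
      simpa using LinearMap.congr_fun h x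
    refine tpowSnoc_hom_ext fun x y => ?_
    rw [LinearMap.comp_apply, tpow_ρ_tpowSnoc, tpowCoord_tpowSnoc, ih, LinearMap.sum_apply,
      sum_fin_succ_pi, Finset.sum_mul]
    refine Finset.sum_congr rfl fun v _ => ?_
    rw [Matrix.mulVec, dotProduct, Finset.mul_sum]
    refine Finset.sum_congr rfl fun a _ => ?_
    rw [LinearMap.smul_apply, tpowCoord_tpowSnoc]
    simp only [Fin.init_snoc, Fin.snoc_last, Fin.prod_univ_castSucc, Fin.snoc_castSucc, smul_eq_mul]
    simp only [Fin.init]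
    ring

end Coordinates

section ColumnTensors
variable {C : Type*} [Fintype C] {m N : ℕ}

/-- The coordinates of the tensor product over the columns `c` of the determinant tensors placed at
the positions `e (c, 0), …, e (c, m - 1)`. -/
def colTensor (R : Type*) [CommRing R] (e : C × Fin m ≃ Fin N) (u : Fin N → Fin m) : R :=
  ∏ c, ((1 : Matrix (Fin m) (Fin m) R).submatrix (fun i => u (e (c, i))) id).det

theorem map_colTensor {R S : Type*} [CommRing R] [CommRing S] (f : R →+* S)
    (e : C × Fin m ≃ Fin N) (u : Fin N → Fin m) : f (colTensor R e u) = colTensor S e u := by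
  simp only [colTensor, map_prod, RingHom.map_det]
  refine Finset.prod_congr rfl fun c _ => ?_
  rw [RingHom.mapMatrix_apply, ← Matrix.submatrix_map, Matrix.map_one f f.map_zero f.map_one]

theorem sum_prod_mul_det_submatrix {R : Type*} [CommRing R] (g : Matrix (Fin m) (Fin m) R)
    (a : Fin m → Fin m) :
    ∑ w : Fin m → Fin m, (∏ i, g (a i) (w i)) *
        ((1 : Matrix (Fin m) (Fin m) R).submatrix w id).det =
      ((1 : Matrix (Fin m) (Fin m) R).submatrix a id).det * g.det := by
  rw [← Matrix.det_mul, ← Matrix.det_submatrix_equiv_self (Equiv.refl _)]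
  have h : ((1 : Matrix (Fin m) (Fin m) R).submatrix a id * g).submatrix (Equiv.refl (Fin m))
      (Equiv.refl (Fin m)) =
      fun i => ∑ j, g (a i) j • (1 : Matrix (Fin m) (Fin m) R) j := by
    ext i j
    simp [Matrix.mul_apply, Matrix.one_apply]
  rw [h]
  have h2 := (Matrix.detRowAlternating (n := Fin m) (R := R)).toMultilinearMap.map_sum
    (fun i j => g (a i) j • (1 : Matrix (Fin m) (Fin m) R) j)
  refine Eq.trans ?_ h2.symm
  refine Finset.sum_congr rfl fun w _ => ?_
  rw [MultilinearMap.map_smul_univ]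
  rfl

theorem sum_prod_mul_colTensor {R : Type*} [CommRing R] (g : Matrix (Fin m) (Fin m) R)
    (hg : g.det = 1) (e : C × Fin m ≃ Fin N) (u : Fin N → Fin m) :
    ∑ v : Fin N → Fin m, (∏ p, g (u p) (v p)) * colTensor R e v = colTensor R e u := by
  classical
  let φ : (C → Fin m → Fin m) ≃ (Fin N → Fin m) :=
    (Equiv.curry C (Fin m) (Fin m)).symm.trans (e.arrowCongr (Equiv.refl _))
  have hφ (W c i) : φ W (e (c, i)) = W c i := by simp [φ]
  rw [← φ.sum_comp]
  simp only [colTensor, hφ, ← e.prod_comp, Fintype.prod_prod_type, ← Finset.prod_mul_distrib]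
  rw [← Fintype.prod_sum fun c w => (∏ i, g (u (e (c, i))) (w i)) *
        ((1 : Matrix (Fin m) (Fin m) R).submatrix w id).det]
  simp only [sum_prod_mul_det_submatrix, hg, mul_one]

theorem isUnit_mul_transpose_of_linearIndependent {ι κ : Type*} [Fintype ι] [DecidableEq ι]
    [Fintype κ] (A : Matrix ι κ ℚ) (hA : LinearIndependent ℚ A.row) : IsUnit (A * A.transpose) := by
  rw [← Matrix.vecMul_injective_iff_isUnit]
  refine (injective_iff_map_eq_zero (Matrix.vecMulLinear (A * A.transpose))).2 fun x hx => ?_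
  have h0 : Matrix.vecMul x A = 0 := by
    rw [← dotProduct_self_eq_zero]
    have : Matrix.vecMul x (A * A.transpose) ⬝ᵥ x = 0 := by
      rw [show Matrix.vecMul x (A * A.transpose) = 0 from hx, zero_dotProduct]
    rwa [← Matrix.vecMul_vecMul, Matrix.vecMul_transpose, dotProduct_comm,
      Matrix.dotProduct_mulVec] at this
  exact Matrix.vecMul_injective_iff.2 hA (by simp only [h0, Matrix.zero_vecMul])

variable {k : Type u} [Field k]

/-- The invariant tensor with coordinates `colTensor k e`. -/
def colVec (e : C × Fin m ≃ Fin N) : (tpow (natRepSL k m) N).V :=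
  ∑ u, colTensor k e u • tpowVec N u

/-- The invariant functional with coefficients `colTensor k e`. -/
def colCoord (e : C × Fin m ≃ Fin N) : (tpow (natRepSL k m) N).V →ₗ[k] k :=
  ∑ u, colTensor k e u • tpowCoord N u

theorem ρ_colVec (g : Matrix.SpecialLinearGroup (Fin m) k) (e : C × Fin m ≃ Fin N) :
    (tpow (natRepSL k m) N).ρ g (colVec e) = colVec e := by
  simp only [colVec, map_sum, map_smul, tpow_ρ_tpowVec, Finset.smul_sum, smul_smul]
  rw [Finset.sum_comm]
  refine Finset.sum_congr rfl fun v _ => ?_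
  rw [← Finset.sum_smul, ← sum_prod_mul_colTensor g.val g.2 e v]
  simp only [mul_comm]

theorem colCoord_ρ (g : Matrix.SpecialLinearGroup (Fin m) k) (e : C × Fin m ≃ Fin N)
    (x : (tpow (natRepSL k m) N).V) :
    colCoord e ((tpow (natRepSL k m) N).ρ g x) = colCoord e x := by
  simp only [colCoord, LinearMap.sum_apply, LinearMap.smul_apply, tpowCoord_ρ, smul_eq_mul,
    Finset.mul_sum, ← mul_assoc]
  rw [Finset.sum_comm]
  refine Finset.sum_congr rfl fun v _ => ?_
  rw [← Finset.sum_mul, ← sum_prod_mul_colTensor g.val.transpose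
    ((Matrix.det_transpose _).trans g.2) e v]
  simp only [mul_comm, Matrix.transpose_apply]

theorem colCoord_colVec (e e' : C × Fin m ≃ Fin N) :
    colCoord (k := k) e (colVec e') = ∑ u, colTensor k e u * colTensor k e' u := by
  simp only [colCoord, colVec, LinearMap.sum_apply, LinearMap.smul_apply, map_sum, map_smul,
    tpowCoord_tpowVec, smul_eq_mul, mul_ite, mul_one, mul_zero, Finset.sum_ite_eq',
    Finset.mem_univ, if_true, mul_comm]

theorem natRepSL_finite : Module.Finite k (natRepSL k m).V :=
  inferInstanceAs (Module.Finite k (Fin m → k))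

theorem le_TS_of_linearIndependent [CharZero k] {n : ℕ} (e : Fin n → C × Fin m ≃ Fin N)
    (h : LinearIndependent ℚ fun j => colTensor ℚ (e j)) : n ≤ TS (tpow (natRepSL k m) N) := by
  have := natRepSL_finite (k := k) (m := m)
  let A : Matrix (Fin n) (Fin N → Fin m) ℚ := fun j => colTensor ℚ (e j)
  let B : Matrix (Fin n) (Fin n) k := (A * A.transpose).map (algebraMap ℚ k)
  have hB : IsUnit B :=
    (isUnit_mul_transpose_of_linearIndependent A h).map (algebraMap ℚ k).mapMatrix
  have hB' (j l) : colCoord (k := k) (e j) (colVec (e l)) = B j l := by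
    rw [colCoord_colVec]
    change _ = algebraMap ℚ k (∑ u, colTensor ℚ (e j) u * colTensor ℚ (e l) u)
    simp only [map_sum, map_mul, map_colTensor]
  let i : (Fin n → k) →ₗ[k] (tpow (natRepSL k m) N).V :=
    Fintype.linearCombination k fun j => colVec (e j)
  let f : (tpow (natRepSL k m) N).V →ₗ[k] (Fin n → k) := LinearMap.pi fun j => colCoord (e j)
  refine le_TS (Rep.ofHom ⟨i, fun g => ?_⟩ : Rep.trivial k _ (Fin n → k) ⟶ _)
    (Rep.ofHom ⟨B⁻¹.mulVecLin ∘ₗ f, fun g => ?_⟩ : _ ⟶ Rep.trivial k _ (Fin n → k)) ?_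
  · refine LinearMap.ext fun x => ?_
    change i x = (tpow (natRepSL k m) N).ρ g (i x)
    simp only [i, Fintype.linearCombination_apply, map_sum, map_smul, ρ_colVec]
  · refine LinearMap.ext fun x => ?_
    change B⁻¹.mulVec (f ((tpow (natRepSL k m) N).ρ g x)) = B⁻¹.mulVec (f x)
    congr 1
    exact funext fun j => colCoord_ρ g (e j) x
  · refine Rep.hom_ext (DFunLike.ext _ _ fun x => ?_)
    change B⁻¹.mulVec (f (i x)) = x
    have : f (i x) = B.mulVec x := by
      ext j
      simp only [f, i, Fintype.linearCombination_apply, map_sum, map_smul, LinearMap.pi_apply,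
        hB', Matrix.mulVec, dotProduct, smul_eq_mul, mul_comm]
    rw [this, Matrix.mulVec_mulVec, Matrix.nonsing_inv_mul _ ((Matrix.isUnit_iff_isUnit_det _).1 hB),
      Matrix.one_mulVec]

end ColumnTensors

section BlockPermutations
variable {C : Type*} [Fintype C] {m : ℕ}

theorem snd_perm_eq_of_injective (s : C → ℕ) (σ : Equiv.Perm (C × Fin m))
    (hσ : ∀ p, s (σ p).1 + (σ p).2 = s p.1 + p.2)
    (hinj : ∀ c, Function.Injective fun i => (σ (c, i)).2) (p : C × Fin m) : (σ p).2 = p.2 := by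
  let F : C × Fin m → ℤ := fun p => (p.2 : ℕ)
  let B : C × Fin m → ℤ := fun p => s p.1 + (p.2 : ℕ)
  have hF (p) : F p = B p - s p.1 := by simp [F, B]
  have hB (p) : B (σ p) = B p := by
    change ((s (σ p).1 : ℕ) : ℤ) + ((σ p).2 : ℕ) = (s p.1 : ℕ) + (p.2 : ℕ)
    exact_mod_cast hσ p
  have h1 : ∑ p, F (σ p) * B p = ∑ p, F p * B p := by
    rw [← Equiv.sum_comp σ fun p => F p * B p]
    exact Finset.sum_congr rfl fun p _ => by rw [hB]
  have h2 : ∑ p, F (σ p) * s p.1 = ∑ p, F p * s p.1 := by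
    simp only [Fintype.sum_prod_type, ← Finset.sum_mul]
    refine Finset.sum_congr rfl fun c _ => ?_
    congr 1
    exact (Equiv.ofBijective _ (Finite.injective_iff_bijective.1 (hinj c))).sum_comp
      fun i => ((i : ℕ) : ℤ)
  have h3 : ∑ p, F (σ p) ^ 2 = ∑ p, F p ^ 2 := Equiv.sum_comp σ fun p => F p ^ 2
  have h4 : ∑ p, F p ^ 2 = ∑ p, F p * B p - ∑ p, F p * s p.1 := by
    rw [← Finset.sum_sub_distrib]
    exact Finset.sum_congr rfl fun p _ => by rw [sq, ← mul_sub, ← hF p]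
  have h5 : ∑ p, (F (σ p) - F p) ^ 2 = 0 := by
    have h (p) : (F (σ p) - F p) ^ 2 =
        F (σ p) ^ 2 - 2 * (F (σ p) * B p) + 2 * (F (σ p) * s p.1) + F p ^ 2 := by
      rw [hF p]; ring
    simp only [h, Finset.sum_add_distrib, Finset.sum_sub_distrib, ← Finset.mul_sum, h1, h2, h3]
    linarith
  have h6 := (Finset.sum_eq_zero_iff_of_nonneg fun p _ => sq_nonneg _).1 h5 p (Finset.mem_univ p)
  have h7 : F (σ p) = F p := by simpa [sub_eq_zero] using h6
  exact Fin.ext (Nat.cast_injective (R := ℤ) h7)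

theorem linearIndependent_colTensor {ι : Type*} {N : ℕ} (s : C → ℕ)
    (e : C × Fin m ≃ Fin N) (π : ι → Equiv.Perm (C × Fin m))
    (hπ : ∀ j p, s (π j p).1 + (π j p).2 = s p.1 + p.2)
    (hinj : Function.Injective fun j p => ((π j).symm p).2) :
    LinearIndependent ℚ fun j => colTensor ℚ ((π j).trans e) := by
  classical
  let w (j : ι) (x : Fin N) : Fin m := ((π j).symm (e.symm x)).2
  have hdual (j l) : colTensor ℚ ((π j).trans e) (w l) = if j = l then 1 else 0 := by
    split_ifs with hjl
    · subst hjl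
      have h1 : (1 : Matrix (Fin m) (Fin m) ℚ).submatrix (fun i => i) id = 1 := rfl
      simp [colTensor, w, h1]
    · by_contra h0
      have h (c) : Function.Injective fun i => ((π l).symm (π j (c, i))).2 := by
        intro i i' hi
        by_contra hne
        refine h0 (Finset.prod_eq_zero (Finset.mem_univ c) (Matrix.det_zero_of_row_eq hne ?_))
        ext t
        simp only [Matrix.submatrix_apply, w, Equiv.trans_apply, Equiv.symm_apply_apply]
        rw [show ((π l).symm (π j (c, i))).2 = _ from hi]
      have key := snd_perm_eq_of_injective s ((π j).trans (π l).symm) (fun p => by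
        have := hπ l ((π l).symm (π j p))
        rw [Equiv.apply_symm_apply, hπ j] at this
        exact this.symm) h
      refine hjl (hinj (funext fun p => ?_))
      have := key ((π j).symm p)
      simpa using this.symm
  rw [linearIndependent_iff']
  intro t g hg j hj
  have := congrFun hg (w j)
  simpa [Finset.sum_apply, hdual, hj] using this

/-- Block-preserving permutations of the cells `(c, i)`, where `(c, i)` lies in block `s c + i`,
that yield distinct words yield linearly independent invariants. -/
theorem card_le_TS {k : Type u} [Field k] [CharZero k] {ι : Type*} [Fintype ι] (s : C → ℕ)
    (π : ι → Equiv.Perm (C × Fin m)) (hπ : ∀ j p, s (π j p).1 + (π j p).2 = s p.1 + p.2)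
    (hinj : Function.Injective fun j p => ((π j).symm p).2) :
    Fintype.card ι ≤ TS (tpow (natRepSL k m) (m * Fintype.card C)) := by
  let e : C × Fin m ≃ Fin (m * Fintype.card C) :=
    Fintype.equivFinOfCardEq (by simp [mul_comm])
  let φ := (Fintype.equivFin ι).symm
  exact le_TS_of_linearIndependent _ ((linearIndependent_colTensor s e π hπ hinj).comp φ φ.injective)

theorem exists_perm_comp_eq {P X : Type*} [Finite P] (f g : P → X)
    (h : ∀ x, Nat.card {p // f p = x} = Nat.card {p // g p = x}) :
    ∃ σ : Equiv.Perm P, ∀ p, f (σ p) = g p :=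
  ⟨Equiv.ofFiberEquiv fun x => (Finite.card_eq.1 (h x)).some.symm,
    fun p => Equiv.ofFiberEquiv_map _ p⟩

/-- The words on `Fin m × Fin l` in which every letter of `Fin m` occurs exactly `l` times. -/
def BalancedWord (m l : ℕ) : Type :=
  {w : Fin m × Fin l → Fin m // ∀ a, Nat.card {q // w q = a} = l}

instance (m l : ℕ) : Finite (BalancedWord m l) := Subtype.finite

/-- The cell `((s, j), i)` lies in block `s + i`; this is the word whose restriction to block
`m + τ` is `w τ` for `τ < T`, and which reads `i` at the cells of the remaining blocks. -/
def blockWord {m l T : ℕ} (w : Fin T → Fin m × Fin l → Fin m) (p : (Fin (T + m) × Fin l) × Fin m) :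
    Fin m :=
  if h : m ≤ p.1.1.val + p.2.val ∧ p.1.1.val + p.2.val - m < T then
    w ⟨p.1.1.val + p.2.val - m, h.2⟩ (p.2, p.1.2) else p.2

theorem blockWord_fst {l T : ℕ} (p : (Fin (T + m) × Fin l) × Fin m) :
    blockWord (fun _ : Fin T => Prod.fst) p = p.2 := by
  unfold blockWord; split_ifs <;> rfl

theorem blockWord_apply {l T : ℕ} (w : Fin T → Fin m × Fin l → Fin m) (τ : Fin T)
    (q : Fin m × Fin l) : blockWord w ((⟨m + τ - q.1, by omega⟩, q.2), q.1) = w τ q := by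
  have h : m + τ.val - q.1.val + q.1.val = m + τ.val := by omega
  unfold blockWord
  rw [dif_pos ⟨by simp only; omega, by simp only; omega⟩]
  congr 1
  exact Fin.ext (by simp only; omega)

theorem blockWord_injective {l T : ℕ} :
    Function.Injective (blockWord : (Fin T → Fin m × Fin l → Fin m) → _) := by
  intro w w' h
  funext τ q
  rw [← blockWord_apply w, h, blockWord_apply]

theorem card_blockWord_fiber {l T : ℕ} (w : Fin T → Fin m × Fin l → Fin m)
    (hw : ∀ τ a, Nat.card {q // w τ q = a} = l) (x : ℕ × Fin m) :
    Nat.card {p : (Fin (T + m) × Fin l) × Fin m //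
        (p.1.1.val + p.2.val, blockWord w p) = x} =
      if m ≤ x.1 ∧ x.1 - m < T then l else
        Nat.card {p : (Fin (T + m) × Fin l) × Fin m // (p.1.1.val + p.2.val, p.2) = x} := by
  obtain ⟨b, a⟩ := x
  split_ifs with h
  · refine Eq.trans ?_ (hw ⟨b - m, h.2⟩ a)
    have hmem (q : {q // w ⟨b - m, h.2⟩ q = a}) :
        (m + (b - m) - q.1.1.val + q.1.1.val,
          blockWord w ((⟨m + (b - m) - q.1.1, by have := h.2; omega⟩, q.1.2), q.1.1)) = (b, a) := by
      refine Prod.ext ?_ ((blockWord_apply w ⟨b - m, h.2⟩ q.1).trans q.2)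
      have := h.1
      simp only
      omega
    refine (Nat.card_congr (Equiv.ofBijective
      (fun q => ⟨((⟨m + (b - m) - q.1.1, by have := h.2; omega⟩, q.1.2), q.1.1), hmem q⟩)
      ⟨?_, ?_⟩)).symm
    · intro q q' hq
      simp only [Subtype.mk.injEq, Prod.mk.injEq] at hq
      exact Subtype.ext (Prod.ext hq.2 hq.1.2)
    · rintro ⟨⟨⟨s, j⟩, i⟩, hp⟩
      simp only [Prod.mk.injEq] at hp
      have hs : s = ⟨m + (b - m) - i, by have := h.2; omega⟩ :=
        Fin.ext (by have := h.1; have := hp.1; simp only; omega)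
      refine ⟨⟨(i, j), ?_⟩, ?_⟩
      · rw [← hp.2, hs]
        exact (blockWord_apply w ⟨b - m, h.2⟩ (i, j)).symm
      · exact Subtype.ext (Prod.ext (Prod.ext hs.symm rfl) rfl)
  · refine Nat.card_congr (Equiv.subtypeEquivRight fun p => ?_)
    simp only [Prod.mk.injEq]
    refine and_congr_right fun hb => ?_
    rw [blockWord, dif_neg (by rw [hb]; exact h)]

theorem card_fst_fiber (l : ℕ) (a : Fin m) : Nat.card {q : Fin m × Fin l // q.1 = a} = l := by
  rw [Nat.card_congr (Equiv.prodSubtypeFstEquivSubtypeProd (p := fun x : Fin m => x = a)), Nat.card_prod]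
  simp

theorem card_balancedWord_pow_le {k : Type u} [Field k] [CharZero k] (l T : ℕ) :
    Nat.card (BalancedWord m l) ^ T ≤ TS (tpow (natRepSL k m) (m * ((T + m) * l))) := by
  have (w : Fin T → BalancedWord m l) : ∃ σ : Equiv.Perm ((Fin (T + m) × Fin l) × Fin m), ∀ p,
      ((σ p).1.1.val + (σ p).2.val, blockWord (fun τ => (w τ).1) (σ p)) =
        (p.1.1.val + p.2.val, p.2) := by
    refine exists_perm_comp_eq
      (fun p : (Fin (T + m) × Fin l) × Fin m =>
        (p.1.1.val + p.2.val, blockWord (fun τ => (w τ).1) p))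
      (fun p => (p.1.1.val + p.2.val, p.2)) fun x => ?_
    rw [card_blockWord_fiber _ fun τ => (w τ).2]
    have := card_blockWord_fiber (fun _ : Fin T => Prod.fst) (fun _ => card_fst_fiber (m := m) l) x
    simp only [blockWord_fst] at this
    exact this.symm
  choose π hπ using this
  have := Fintype.ofFinite (BalancedWord m l)
  have h := card_le_TS (k := k) (fun c : Fin (T + m) × Fin l => c.1.val) π
    (fun w p => (Prod.ext_iff.1 (hπ w p)).1) fun w w' hw => ?_
  · simpa [Nat.card_eq_fintype_card] using h
  · have hb (w p) : ((π w).symm p).2 = blockWord (fun τ => (w τ).1) p := by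
      simpa using (Prod.ext_iff.1 (hπ w ((π w).symm p))).2.symm
    simp only [hb] at hw
    exact funext fun τ => Subtype.ext (congrFun (blockWord_injective hw) τ)

end BlockPermutations

section Growth

/-- Pigeonhole on the letter counts of words of length `l`; cyclically shifting the letters of `m`
words with equal counts and concatenating them gives a balanced word. -/
theorem pow_le_card_balancedWord (m l : ℕ) [NeZero m] :
    ((m : ℝ) ^ l / (l + 1 : ℝ) ^ m) ^ m ≤ Nat.card (BalancedWord m l) := by
  classical
  let content (u : Fin l → Fin m) (a : Fin m) : Fin (l + 1) :=
    ⟨Fintype.card {x // u x = a}, Nat.lt_succ_of_le (by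
      simpa using Fintype.card_subtype_le fun x => u x = a)⟩
  obtain ⟨c, hc⟩ := Fintype.exists_le_card_fiber_of_nsmul_le_card content
    (b := (m : ℝ) ^ l / (l + 1 : ℝ) ^ m) (by
      have : ((l : ℝ) + 1) ^ m ≠ 0 := by positivity
      simp [mul_div_cancel₀ _ this])
  have hcard (u : {u // content u = c}) (a : Fin m) : Nat.card {x // u.1 x = a} = c a := by
    rw [Nat.card_eq_fintype_card]
    exact congrArg Fin.val (congrFun u.2 a)
  have hsum (u : {u // content u = c}) : ∑ a, (c a : ℕ) = l := by
    simp only [← hcard u, ← Nat.card_sigma]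
    rw [Nat.card_congr (Equiv.sigmaFiberEquiv u.1), Nat.card_fin]
  let F (U : Fin m → {u // content u = c}) : BalancedWord m l :=
    ⟨fun q => (U q.1).1 q.2 + q.1, fun a => by
      let E : {q : Fin m × Fin l // (U q.1).1 q.2 + q.1 = a} ≃
          Σ i : Fin m, {x // (U i).1 x = a - i} :=
        { toFun := fun q => ⟨q.1.1, q.1.2, eq_sub_of_add_eq q.2⟩
          invFun := fun p => ⟨(p.1, p.2.1), add_eq_of_eq_sub p.2.2⟩
          left_inv := fun _ => rfl
          right_inv := fun _ => rfl }
      rw [Nat.card_congr E, Nat.card_sigma]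
      simp only [hcard]
      exact ((Equiv.subLeft a).sum_comp fun i => (c i : ℕ)).trans (hsum (U 0))⟩
  have hF : Function.Injective F := fun U U' h => by
    funext i
    refine Subtype.ext (funext fun x => ?_)
    exact add_right_cancel (congrFun (congrArg Subtype.val h) (i, x))
  have h := Nat.card_le_card_of_injective F hF
  rw [Nat.card_fun, Nat.card_fin, Nat.card_eq_fintype_card, Fintype.card_subtype] at h
  calc ((m : ℝ) ^ l / (l + 1 : ℝ) ^ m) ^ m ≤ _ := pow_le_pow_left₀ (by positivity) hc m
    _ ≤ _ := by exact_mod_cast h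

theorem tendsto_rpow_inv_of_supermul {a : ℕ → ℕ} {m : ℕ} (hm : 0 < m) (hpos : ∀ n, 0 < a n)
    (hmul : ∀ l j, a l * a j ≤ a (l + j)) (hle : ∀ n, a n ≤ m ^ (m * n))
    (hge : ∀ l T : ℕ, (((m : ℝ) ^ l / (l + 1 : ℝ) ^ m) ^ m) ^ T ≤ a ((T + m) * l)) :
    Filter.Tendsto (fun n : ℕ => (a n : ℝ) ^ (((m : ℝ) * (n : ℝ))⁻¹)) Filter.atTop
      (nhds (m : ℝ)) := by
  have hpos' (n) : (0 : ℝ) < a n := by exact_mod_cast hpos n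
  have hm' : (0 : ℝ) < m := by exact_mod_cast hm
  have hsub : Subadditive fun n => -Real.log (a n) := fun l j => by
    have h : ((a l : ℝ) * a j) ≤ a (l + j) := by exact_mod_cast hmul l j
    have := Real.log_le_log (mul_pos (hpos' l) (hpos' j)) h
    rw [Real.log_mul (hpos' l).ne' (hpos' j).ne'] at this
    linarith
  have hlog (n) : Real.log (a n) ≤ m * Real.log m * n := by
    have h : (a n : ℝ) ≤ (m : ℝ) ^ (m * n) := by exact_mod_cast hle n
    have := Real.log_le_log (hpos' n) h
    rw [Real.log_pow] at this
    push_cast at this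
    linarith
  have hmlog : 0 ≤ m * Real.log m := mul_nonneg hm'.le (Real.log_natCast_nonneg m)
  have hbound (n : ℕ) : -(m * Real.log m) ≤ -Real.log (a n) / n := by
    rcases Nat.eq_zero_or_pos n with rfl | hn
    · simpa using hmlog
    · rw [le_div_iff₀ (by exact_mod_cast hn)]
      linarith [hlog n]
  have hbdd : BddBelow (Set.range fun n : ℕ => -Real.log (a n) / n) :=
    ⟨-(m * Real.log m), by rintro _ ⟨n, rfl⟩; exact hbound n⟩
  have hlim := hsub.tendsto_lim hbdd
  have hlower : -(m * Real.log m) ≤ hsub.lim := ge_of_tendsto' hlim hbound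
  have hupper : hsub.lim ≤ -(m * Real.log m) := by
    have hle (l : ℕ) (hl : 0 < l) : hsub.lim ≤
        -(m * Real.log m) * (l / (l + m)) + m * m * (Real.log (l + 1) / (l + m)) := by
      have hl' : (0 : ℝ) < l := by exact_mod_cast hl
      refine (hsub.lim_le_div hbdd (n := (l + m) * l) (by positivity)).trans ?_
      have h := Real.log_le_log (by positivity) (hge l l)
      rw [Real.log_pow, Real.log_pow, Real.log_div (by positivity) (by positivity), Real.log_pow,
        Real.log_pow] at h
      rw [div_le_iff₀ (by positivity)]
      push_cast
      have : (-(m * Real.log m) * (l / (l + m)) + m * m * (Real.log (l + 1) / (l + m))) *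
          ((l + m) * l) = -(l * (m * (l * Real.log m - m * Real.log (l + 1)))) := by
        field_simp
        ring
      rw [this]
      linarith
    have h1 : Filter.Tendsto (fun l : ℕ => (l : ℝ) / (l + m)) Filter.atTop (nhds 1) :=
      tendsto_natCast_div_add_atTop (m : ℝ)
    have h2 : Filter.Tendsto (fun l : ℕ => Real.log (l + 1) / (l + m : ℝ)) Filter.atTop
        (nhds 0) := by
      have := (Real.tendsto_pow_log_div_mul_add_atTop 1 (m - 1) 1 one_ne_zero).comp
        (Filter.tendsto_atTop_add_const_right _ (1 : ℝ) tendsto_natCast_atTop_atTop)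
      refine this.congr fun l => ?_
      simp only [Function.comp_apply, pow_one, one_mul]
      congr 1
      ring
    have h3 := (h1.const_mul (-(m * Real.log m))).add (h2.const_mul ((m : ℝ) * m))
    rw [mul_one, mul_zero, add_zero] at h3
    exact ge_of_tendsto h3 ((Filter.eventually_gt_atTop 0).mono hle)
  have heq := le_antisymm hupper hlower
  rw [heq] at hlim
  have := (Real.continuous_exp.tendsto _).comp (hlim.mul_const (-(m : ℝ)⁻¹))
  rw [show -(m * Real.log m) * -(m : ℝ)⁻¹ = Real.log m by field_simp, Real.exp_log hm'] at this
  refine this.congr fun n => ?_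
  rw [Function.comp_apply, Real.rpow_def_of_pos (hpos' n), mul_inv]
  congr 1
  ring

end Growth

/-- **Remark.** The sequence `a_n = TS_{SL(V)}(V^{⊗mn})` is positive and supermultiplicative,
and `TS_{SL(V)}(V^{⊗mn})^{1/(mn)}` converges with limit `m`. -/
theorem TS_SL_pos_supermul_tendsto {k : Type u} [Field k] [IsAlgClosed k] [CharZero k]
    {m : ℕ} (hm : 0 < m) :
    (∀ n : ℕ, 0 < TS (tpow (natRepSL k m) (m * n))) ∧
      (∀ l j : ℕ,
        TS (tpow (natRepSL k m) (m * l)) * TS (tpow (natRepSL k m) (m * j)) ≤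
          TS (tpow (natRepSL k m) (m * (l + j)))) ∧
      Filter.Tendsto
        (fun n : ℕ => (TS (tpow (natRepSL k m) (m * n)) : ℝ) ^ (((m : ℝ) * (n : ℝ))⁻¹))
        Filter.atTop (nhds (m : ℝ)) := by
  have := natRepSL_finite (k := k) (m := m)
  have : NeZero m := ⟨hm.ne'⟩
  have hmul (l j : ℕ) : TS (tpow (natRepSL k m) (m * l)) * TS (tpow (natRepSL k m) (m * j)) ≤
      TS (tpow (natRepSL k m) (m * (l + j))) := by
    rw [mul_add, TS_congr (tpowAddIso _ _ _)]
    exact TS_mul_le _ _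
  have hpos (n : ℕ) : 0 < TS (tpow (natRepSL k m) (m * n)) := by
    have h := card_le_TS (k := k) (m := m) (ι := Unit) (fun _ : Fin n => 0) (fun _ => Equiv.refl _)
      (fun _ _ => rfl) (Function.injective_of_subsingleton _)
    rw [Fintype.card_fin] at h
    exact h
  refine ⟨hpos, hmul, tendsto_rpow_inv_of_supermul hm hpos hmul (fun n => ?_) fun l T => ?_⟩
  · refine (TS_le_finrank _).trans_eq ?_
    rw [finrank_tpow]
    congr 1
    exact Module.finrank_fin_fun k
  · refine (pow_le_pow_left₀ (by positivity) (pow_le_card_balancedWord m l) T).trans ?_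
    exact_mod_cast card_balancedWord_pow_le (k := k) (m := m) l T
end
end
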